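/- (Aggregate delay-based service guarantee, used in the proof of Theorem 2) If ρ = Σ_n r_n/C(n) ≤ 1 and D = Σ_n σ_n/C(n), then for all t ≥ 0 the cumulative aggregate departure dominates the shifted aggregate arrival: A*(t + D) ≥ A(t); equivalently, the system provides the aggregate input the service curve δ_D, where δ_D(t) = 0 for 0 ≤ t ≤ D and δ_D(t) = ∞ for t > D. -/

import Mathlib

open scoped Classical BigOperators

/-- Unrolling the FIFO recursion to the start of a busy period: each departure time is the arrival
time of an earlier packet plus the total service time since then. -/
theorem exists_departure_eq_arrival_add_sum {a d w : ℕ → ℝ} (ha0 : ∀ j, 0 ≤ a j) (hd0 : d 0 = 0)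
    (hd : ∀ j, 1 ≤ j → d j = max (a j) (d (j - 1)) + w j) {j : ℕ} (hj : 1 ≤ j) :
    ∃ k, 1 ≤ k ∧ k ≤ j ∧ d j = a k + ∑ i ∈ Finset.Icc k j, w i := by
  induction j, hj using Nat.le_induction with
  | base => exact ⟨1, le_rfl, le_rfl, by simp [hd 1 le_rfl, hd0, ha0 1]⟩
  | succ j hj ih =>
    obtain ⟨k, hk1, hkj, hk⟩ := ih
    have hdj := hd (j + 1) (by lia)
    rw [Nat.add_sub_cancel] at hdj
    rcases le_total (a (j + 1)) (d j) with h | h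
    · refine ⟨k, hk1, by lia, ?_⟩
      rw [hdj, max_eq_right h, hk, Finset.sum_Icc_succ_top (by lia), add_assoc]
    · exact ⟨j + 1, by lia, le_rfl, by simp [hdj, max_eq_left h]⟩

/-- A series of terms restricted to a finite set of indices is summable. -/
theorem summable_ite_of_finite {p : ℕ → Prop} [DecidablePred p] (f : ℕ → ℝ) (hp : {j | p j}.Finite) :
    Summable fun j => if p j then f j else 0 := by
  refine summable_of_hasFiniteSupport (hp.subset fun j hj => ?_)
  by_contra h
  exact hj (if_neg h)

/-- Aggregate delay-based service guarantee (used in the proof of Theorem 2):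
if `ρ = ∑ n, r n / C n ≤ 1` and `D = ∑ n, σ n / C n`, then for all `t ≥ 0`,
`A*(t + D) ≥ A(t)`. -/
theorem multiclass_fifo_aggregate_delta_service_curve
    (N : ℕ) (hN : 0 < N)
    (C : Fin N → ℝ) (hC : ∀ n, 0 < C n)
    (a l : ℕ → ℝ) (c : ℕ → Fin N)
    (ha0 : ∀ j, 0 ≤ a j) (hamono : Monotone a)
    (hl : ∀ j, 1 ≤ j → 0 < l j)
    (hfin : ∀ t : ℝ, {j : ℕ | a j ≤ t}.Finite)
    (d : ℕ → ℝ) (hd0 : d 0 = 0)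
    (hd : ∀ j, 1 ≤ j → d j = max (a j) (d (j - 1)) + l j / C (c j))
    (A Astar : ℝ → ℝ)
    (hA : ∀ t, A t = ∑' j : ℕ, if 1 ≤ j ∧ a j ≤ t then l j else 0)
    (hAstar : ∀ t, Astar t = ∑' j : ℕ, if 1 ≤ j ∧ d j ≤ t then l j else 0)
    (r σ : Fin N → ℝ) (hr : ∀ n, 0 ≤ r n) (hσ : ∀ n, 0 ≤ σ n)
    (harr : ∀ n : Fin N, ∀ s t : ℝ, 0 ≤ s → s ≤ t →
      (∑' j : ℕ, if 1 ≤ j ∧ c j = n ∧ s ≤ a j ∧ a j ≤ t then l j else 0)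
        ≤ r n * (t - s) + σ n)
    (hρ : ∑ n, r n / C n ≤ 1) :
    ∀ t : ℝ, 0 ≤ t → A t ≤ Astar (t + ∑ n, σ n / C n) := by
  have delay : ∀ j, 1 ≤ j → d j ≤ a j + ∑ n, σ n / C n := by
    intro j hj
    obtain ⟨k, hk1, hkj, hk⟩ :=
      exists_departure_eq_arrival_add_sum (w := fun i => l i / C (c i)) ha0 hd0 hd hj
    have hakj : a k ≤ a j := hamono hkj
    have class_work : ∀ n, ∑ i ∈ Finset.Icc k j with c i = n, l i / C (c i)
        ≤ r n / C n * (a j - a k) + σ n / C n := by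
      intro n
      have hsum : ∑ i ∈ Finset.Icc k j with c i = n, l i ≤ r n * (a j - a k) + σ n := by
        refine le_trans ?_ (harr n (a k) (a j) (ha0 k) hakj)
        have hs : Summable fun i : ℕ =>
            if 1 ≤ i ∧ c i = n ∧ a k ≤ a i ∧ a i ≤ a j then l i else 0 :=
          summable_ite_of_finite l ((hfin (a j)).subset fun i hi => hi.2.2.2)
        refine le_trans (Finset.sum_le_sum fun i hi => ?_)
          (hs.sum_le_tsum (Finset.filter (fun i => c i = n) (Finset.Icc k j)) fun i _ => ?_)
        · simp only [Finset.mem_filter, Finset.mem_Icc] at hi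
          rw [if_pos ⟨hk1.trans hi.1.1, hi.2, hamono hi.1.1, hamono hi.1.2⟩]
        · split_ifs with h
          exacts [(hl i h.1).le, le_rfl]
      calc ∑ i ∈ Finset.Icc k j with c i = n, l i / C (c i)
          = (∑ i ∈ Finset.Icc k j with c i = n, l i) / C n := by
            rw [Finset.sum_div]
            exact Finset.sum_congr rfl fun i hi => by rw [(Finset.mem_filter.mp hi).2]
        _ ≤ (r n * (a j - a k) + σ n) / C n := div_le_div_of_nonneg_right hsum (hC n).le
        _ = r n / C n * (a j - a k) + σ n / C n := by ring
    have work : ∑ i ∈ Finset.Icc k j, l i / C (c i) ≤ (a j - a k) + ∑ n, σ n / C n := by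
      calc ∑ i ∈ Finset.Icc k j, l i / C (c i)
          = ∑ n, ∑ i ∈ Finset.Icc k j with c i = n, l i / C (c i) :=
            (Finset.sum_fiberwise _ _ _).symm
        _ ≤ ∑ n, (r n / C n * (a j - a k) + σ n / C n) :=
            Finset.sum_le_sum fun n _ => class_work n
        _ = (∑ n, r n / C n) * (a j - a k) + ∑ n, σ n / C n := by
            rw [Finset.sum_add_distrib, Finset.sum_mul]
        _ ≤ (a j - a k) + ∑ n, σ n / C n := by
            gcongr
            exact mul_le_of_le_one_left (sub_nonneg.mpr hakj) hρ
    linarith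
  have arrival_le : ∀ j, 1 ≤ j → a j ≤ d j := fun j hj => by
    rw [hd j hj]
    exact (le_max_left _ _).trans
      (le_add_of_nonneg_right (div_nonneg (hl j hj).le (hC _).le))
  intro t _
  rw [hA, hAstar]
  refine Summable.tsum_le_tsum (fun j => ?_)
    (summable_ite_of_finite l ((hfin t).subset fun j hj => hj.2))
    (summable_ite_of_finite l ((hfin (t + ∑ n, σ n / C n)).subset
      fun j hj => (arrival_le j hj.1).trans hj.2))
  by_cases h : 1 ≤ j ∧ a j ≤ t
  · rw [if_pos h, if_pos ⟨h.1, (delay j h.1).trans (by linarith [h.2])⟩]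
  · rw [if_neg h]
    split_ifs with h'
    exacts [(hl j h'.1).le, le_rfl]
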